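/- arXiv:2009.05155 — 2 statements merged into one kernel-verified Lean document; each statement's English description precedes it below -/
import Mathlib

section
/- Fix p ∈ (0,1). There exist a constant C > 0 and N ∈ ℕ such that for all n ≥ N, the expected largest adjacency eigenvalue under the Erdős–Rényi measure G(n,p) satisfies | E_{G(n,p)}[λ1] − ( (n−1)p + (1−p) ) | ≤ C/n. -/
open scoped Classical
open Finset

/-- The real adjacency matrix of a simple graph on `Fin n`. -/
noncomputable def adjMat {n : ℕ} (g : SimpleGraph (Fin n)) : Matrix (Fin n) (Fin n) ℝ :=
  g.adjMatrix ℝ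

/-- The number of edges of a simple graph on `Fin n`. -/
noncomputable def edgeCount {n : ℕ} (g : SimpleGraph (Fin n)) : ℕ := g.edgeFinset.card

/-- The Erdős–Rényi `G(n,p)` probability of a single graph `g`:
`p ^ m (1-p) ^ (C(n,2) - m)` where `m` is the number of edges of `g`. -/
noncomputable def erWeight (n : ℕ) (p : ℝ) (g : SimpleGraph (Fin n)) : ℝ :=
  p ^ edgeCount g * (1 - p) ^ (n.choose 2 - edgeCount g)

/-- The Erdős–Rényi `G(n,p)` expectation of a functional `f` of the graph. -/
noncomputable def erExp (n : ℕ) (p : ℝ) (f : SimpleGraph (Fin n) → ℝ) : ℝ :=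
  ∑ g : SimpleGraph (Fin n), erWeight n p g * f g

/-- The largest eigenvalue of a real matrix, as the supremum of its spectrum. -/
noncomputable def lam1 {n : ℕ} (M : Matrix (Fin n) (Fin n) ℝ) : ℝ := sSup (spectrum ℝ M)

section LinearAlgebra

open Matrix

variable {ι : Type*} [Fintype ι]

lemma dotProduct_mulVec_of_isSymm {W : Matrix ι ι ℝ} (hW : W.IsSymm) (x y : ι → ℝ) :
    x ⬝ᵥ (W *ᵥ y) = (W *ᵥ x) ⬝ᵥ y := by
  rw [dotProduct_mulVec, ← mulVec_transpose, hW.eq]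

lemma dotProduct_sq_le (x y : ι → ℝ) : (x ⬝ᵥ y) ^ 2 ≤ (x ⬝ᵥ x) * (y ⬝ᵥ y) := by
  simpa [dotProduct, sq] using sum_mul_sq_le_sq_mul_sq univ x y

lemma dotProduct_self_nonneg_real (x : ι → ℝ) : 0 ≤ x ⬝ᵥ x :=
  sum_nonneg fun i _ => mul_self_nonneg (x i)

lemma mulVec_dotProduct_self_le (M : Matrix ι ι ℝ) (x : ι → ℝ) :
    (M *ᵥ x) ⬝ᵥ (M *ᵥ x) ≤ (∑ i, ∑ j, M i j ^ 2) * (x ⬝ᵥ x) := by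
  rw [dotProduct, sum_mul]
  refine sum_le_sum fun i _ => ?_
  have h := sum_mul_sq_le_sq_mul_sq univ (M i) x
  simpa [mulVec, dotProduct, sq] using h

lemma mulVec_dotProduct_self_le_of_sq {W : Matrix ι ι ℝ} (hW : W.IsSymm) {L : ℝ} (hL : 0 ≤ L)
    (h : ∑ i, ∑ j, (W * W) i j ^ 2 ≤ L ^ 2) (x : ι → ℝ) :
    (W *ᵥ x) ⬝ᵥ (W *ᵥ x) ≤ L * (x ⬝ᵥ x) := by
  have hx := dotProduct_self_nonneg_real x
  refine abs_le_of_sq_le_sq' ?_ (by positivity) |>.2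
  have h1 : (W *ᵥ x) ⬝ᵥ (W *ᵥ x) = x ⬝ᵥ ((W * W) *ᵥ x) := by
    rw [← mulVec_mulVec, ← dotProduct_mulVec_of_isSymm hW]
  rw [h1]
  calc _ ≤ (x ⬝ᵥ x) * (((W * W) *ᵥ x) ⬝ᵥ ((W * W) *ᵥ x)) := dotProduct_sq_le _ _
    _ ≤ (x ⬝ᵥ x) * (L ^ 2 * (x ⬝ᵥ x)) := by
      gcongr
      exact (mulVec_dotProduct_self_le _ _).trans (by gcongr)
    _ = _ := by ring

variable [DecidableEq ι]

lemma sSup_spectrum_mem [Nonempty ι] {A : Matrix ι ι ℝ} (hA : A.IsHermitian) :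
    sSup (spectrum ℝ A) ∈ spectrum ℝ A := by
  refine Set.Nonempty.csSup_mem ?_ A.finite_real_spectrum
  exact hA.spectrum_real_eq_range_eigenvalues ▸ Set.range_nonempty _

lemma exists_mulVec_eq_sSup_spectrum [Nonempty ι] {A : Matrix ι ι ℝ} (hA : A.IsHermitian) :
    ∃ u : ι → ℝ, u ≠ 0 ∧ A *ᵥ u = sSup (spectrum ℝ A) • u := by
  have h := sSup_spectrum_mem hA
  rw [← spectrum_toLin', ← Module.End.hasEigenvalue_iff_mem_spectrum] at h
  obtain ⟨u, hu⟩ := h.exists_hasEigenvector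
  exact ⟨u, hu.2, by simpa using hu.apply_eq_smul⟩

lemma dotProduct_mulVec_le_sSup_spectrum {A : Matrix ι ι ℝ} (hA : A.IsHermitian) (x : ι → ℝ) :
    x ⬝ᵥ (A *ᵥ x) ≤ sSup (spectrum ℝ A) * (x ⬝ᵥ x) := by
  set l := sSup (spectrum ℝ A)
  have hpsd : (algebraMap ℝ (Matrix ι ι ℝ) l - A).PosSemidef := by
    rw [posSemidef_iff_isHermitian_and_spectrum_nonneg]
    refine ⟨?_, fun a ha => ?_⟩
    · refine IsHermitian.sub ?_ hA
      simp [IsHermitian, algebraMap_eq_diagonal]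
    · rw [← spectrum.singleton_sub_eq] at ha
      obtain ⟨b, hb, c, hc, rfl⟩ := ha
      rw [Set.mem_singleton_iff] at hb
      subst hb
      exact sub_nonneg.2 (le_csSup A.finite_real_spectrum.bddAbove hc)
  have := hpsd.dotProduct_mulVec_nonneg x
  rw [sub_mulVec, dotProduct_sub, Algebra.algebraMap_eq_smul_one, smul_mulVec, one_mulVec,
    dotProduct_smul] at this
  simpa using this

lemma abs_sSup_spectrum_le [Nonempty ι] {A : Matrix ι ι ℝ} (hA : A.IsHermitian)
    (h1 : ∀ i j, |A i j| ≤ 1) : |sSup (spectrum ℝ A)| ≤ Fintype.card ι := by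
  obtain ⟨u, hu, h⟩ := exists_mulVec_eq_sSup_spectrum hA
  have hpos : 0 < u ⬝ᵥ u :=
    lt_of_le_of_ne (dotProduct_self_nonneg_real u) (Ne.symm (by simpa using hu))
  have h2 := mulVec_dotProduct_self_le A u
  have h3 : ∑ i, ∑ j, A i j ^ 2 ≤ (Fintype.card ι : ℝ) ^ 2 := by
    calc _ ≤ ∑ i : ι, ∑ j : ι, (1 : ℝ) := by
          gcongr with i _ j _
          exact (sq_le_one_iff_abs_le_one _).2 (h1 i j)
      _ = _ := by simp [sq]
  rw [h, smul_dotProduct, dotProduct_smul, smul_eq_mul, smul_eq_mul, ← mul_assoc, ← sq] at h2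
  refine abs_le_of_sq_le_sq ?_ (by positivity)
  exact (le_of_mul_le_mul_right h2 hpos).trans h3

end LinearAlgebra

set_option maxHeartbeats 800000 in
lemma abs_sub_expansion_le {p N t σ Δ q κ r δ : ℝ} (hp : p ∈ Set.Ioo (0 : ℝ) 1) (hN : 0 < N)
    (ht : 3 * p / 4 ≤ t) (hδ : δ = N * (t - p))
    (heq : δ = p * σ / t + p * Δ / t ^ 2 + p * q / t ^ 3 + r) (hr : |r| ≤ 2 * κ / t ^ 3)
    (hκ0 : 0 ≤ κ) (hκ : κ ≤ Δ) (hq : |q| ≤ Δ) (hΔκ : Δ ^ 2 ≤ N * κ) :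
    |δ - σ - Δ / p - q / p ^ 2| ≤ 52 * (2 / p) ^ 6 * (κ + σ ^ 2 / N) := by
  obtain ⟨hp0, hp1⟩ := hp
  have htpos : 0 < t := by linarith
  have hΔ : 0 ≤ Δ := hκ0.trans hκ
  set b := 2 / p with hb
  set τ := 1 / t with hτ
  have hτ0 : 0 < τ := by positivity
  have hb2 : 2 ≤ b := by
    rw [hb, le_div_iff₀ hp0]; linarith
  have hτb : τ ≤ b := by
    rw [hτ, hb, div_le_div_iff₀ htpos hp0]; linarith
  have hpb : 1 / p ≤ b := by
    rw [hb]; gcongr; norm_num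
  have hp' : 0 < 1 / p := by positivity
  have hb1 : b ≤ b ^ 3 := le_self_pow₀ (by linarith) (by norm_num)
  have hb22 : b ^ 2 ≤ b ^ 3 := pow_le_pow_right₀ (by linarith) (by norm_num)
  have hb36 : b ^ 3 ≤ b ^ 6 := pow_le_pow_right₀ (by linarith) (by norm_num)
  have hr' : |r| ≤ 2 * b ^ 3 * κ := by
    calc |r| ≤ 2 * κ * τ ^ 3 := by rw [hτ]; simpa [div_eq_mul_inv] using hr
      _ ≤ 2 * κ * b ^ 3 := by gcongr
      _ = _ := by ring
  have hσ0 := abs_nonneg σ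
  have hq0 := abs_nonneg q
  have eτ : δ = p * τ * σ + p * τ ^ 2 * Δ + p * τ ^ 3 * q + r := by
    rw [heq, hτ]; ring
  have hδb : |δ| ≤ 5 * b ^ 3 * (|σ| + Δ) := by
    have h1 : p * τ ≤ b ^ 3 := by nlinarith
    have h2 : p * τ ^ 2 ≤ b ^ 3 := by
      have : τ ^ 2 ≤ b ^ 2 := by gcongr
      nlinarith [sq_nonneg τ]
    have h3 : p * τ ^ 3 ≤ b ^ 3 := by
      have : τ ^ 3 ≤ b ^ 3 := by gcongr
      nlinarith [pow_pos hτ0 3]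
    calc |δ| ≤ |p * τ * σ| + |p * τ ^ 2 * Δ| + |p * τ ^ 3 * q| + |r| := by
          rw [eτ]
          refine (abs_add_le _ _).trans (add_le_add_left ?_ _)
          exact abs_add_three _ _ _
      _ = p * τ * |σ| + p * τ ^ 2 * Δ + p * τ ^ 3 * |q| + |r| := by
          rw [abs_mul (p * τ), abs_mul (p * τ ^ 2), abs_mul (p * τ ^ 3), abs_of_nonneg hΔ,
            abs_of_pos (by positivity : 0 < p * τ), abs_of_pos (by positivity : 0 < p * τ ^ 2),
            abs_of_pos (by positivity : 0 < p * τ ^ 3)]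
      _ ≤ b ^ 3 * |σ| + b ^ 3 * Δ + b ^ 3 * Δ + 2 * b ^ 3 * Δ := by
          have : 2 * b ^ 3 * κ ≤ 2 * b ^ 3 * Δ := by gcongr
          gcongr
          linarith
      _ ≤ _ := by
        have : 0 ≤ b ^ 3 := by positivity
        linarith [mul_nonneg this hΔ, mul_nonneg this hσ0]
  set ρ := 1 / p with hρ
  have e : δ - σ - Δ / p - q / p ^ 2 =
      -(δ / N) * (τ * σ + (τ ^ 2 + τ * ρ) * Δ + (τ ^ 3 + τ ^ 2 * ρ + τ * ρ ^ 2) * q) + r := by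
    have e1 : -(δ / N) = p - t := by
      rw [hδ]; field_simp; ring
    have hpρ : p * ρ = 1 := by rw [hρ]; field_simp
    have htτ : t * τ = 1 := by rw [hτ]; field_simp
    have hΔp : Δ / p = ρ * Δ := by rw [hρ]; ring
    have hqp : q / p ^ 2 = ρ ^ 2 * q := by rw [hρ]; ring
    rw [e1, hΔp, hqp]
    linear_combination eτ + htτ * (σ + (τ + ρ) * Δ + (τ ^ 2 + τ * ρ + ρ ^ 2) * q) -
      hpρ * (τ * Δ + (τ ^ 2 + τ * ρ) * q)
  have hin : |τ * σ + (τ ^ 2 + τ * ρ) * Δ + (τ ^ 3 + τ ^ 2 * ρ + τ * ρ ^ 2) * q|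
      ≤ 5 * b ^ 3 * (|σ| + Δ) := by
    have h2 : τ ^ 2 + τ * ρ ≤ b ^ 2 + b * b := by gcongr
    have h3 : τ ^ 3 + τ ^ 2 * ρ + τ * ρ ^ 2 ≤ b ^ 3 + b ^ 2 * b + b * b ^ 2 := by gcongr
    calc _ ≤ |τ * σ| + |(τ ^ 2 + τ * ρ) * Δ| + |(τ ^ 3 + τ ^ 2 * ρ + τ * ρ ^ 2) * q| :=
          abs_add_three _ _ _
      _ = τ * |σ| + (τ ^ 2 + τ * ρ) * Δ + (τ ^ 3 + τ ^ 2 * ρ + τ * ρ ^ 2) * |q| := by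
          rw [abs_mul τ, abs_mul (τ ^ 2 + τ * ρ), abs_mul (τ ^ 3 + τ ^ 2 * ρ + τ * ρ ^ 2),
            abs_of_nonneg hΔ, abs_of_pos hτ0, abs_of_pos (by positivity : 0 < τ ^ 2 + τ * ρ),
            abs_of_pos (by positivity : 0 < τ ^ 3 + τ ^ 2 * ρ + τ * ρ ^ 2)]
      _ ≤ b ^ 3 * |σ| + (2 * b ^ 3) * Δ + (3 * b ^ 3) * Δ := by
          gcongr
          · linarith
          · linarith
          · linarith
      _ ≤ _ := by
        have : 0 ≤ b ^ 3 := by positivity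
        linarith [mul_nonneg this hΔ, mul_nonneg this hσ0]
  have hsq : (|σ| + Δ) ^ 2 / N ≤ 2 * (κ + σ ^ 2 / N) := by
    have h1 : (|σ| + Δ) ^ 2 ≤ 2 * (N * κ + σ ^ 2) := by
      nlinarith [sq_nonneg (|σ| - Δ), sq_abs σ]
    calc _ ≤ 2 * (N * κ + σ ^ 2) / N := by gcongr
      _ = _ := by field_simp
  have hnn : 0 ≤ σ ^ 2 / N := by positivity
  calc |δ - σ - Δ / p - q / p ^ 2|
      ≤ |δ| / N * (5 * b ^ 3 * (|σ| + Δ)) + 2 * b ^ 3 * κ := by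
        rw [e]
        refine (abs_add_le _ _).trans ?_
        rw [abs_mul, abs_neg, abs_div, abs_of_pos hN]
        gcongr
    _ ≤ 5 * b ^ 3 * (|σ| + Δ) / N * (5 * b ^ 3 * (|σ| + Δ)) + 2 * b ^ 3 * κ := by gcongr
    _ = 25 * b ^ 6 * ((|σ| + Δ) ^ 2 / N) + 2 * b ^ 3 * κ := by ring
    _ ≤ 25 * b ^ 6 * (2 * (κ + σ ^ 2 / N)) + 2 * b ^ 6 * κ := by gcongr
    _ ≤ _ := by
      have : 0 ≤ b ^ 6 := by positivity
      linarith [mul_nonneg this hnn, mul_nonneg this hκ0]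

section Expansion

open Matrix

variable {ι : Type*} [Fintype ι]

lemma abs_dotProduct_mulVec_le {W : Matrix ι ι ℝ} {L : ℝ} (hL : 0 ≤ L)
    (hop : ∀ x, (W *ᵥ x) ⬝ᵥ (W *ᵥ x) ≤ L ^ 2 * (x ⬝ᵥ x)) (x : ι → ℝ) :
    |x ⬝ᵥ (W *ᵥ x)| ≤ L * (x ⬝ᵥ x) := by
  have hx := dotProduct_self_nonneg_real x
  refine abs_le_of_sq_le_sq ?_ (by positivity)
  calc _ ≤ _ := dotProduct_sq_le _ _
    _ ≤ (x ⬝ᵥ x) * (L ^ 2 * (x ⬝ᵥ x)) := by gcongr; exact hop x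
    _ = _ := by ring

variable [DecidableEq ι]

/-- The data of a resolvent expansion of the top eigenvalue `θ` of `p J + W`,
where `a` is the remainder after three steps. -/
lemma exists_resolvent_expansion [Nonempty ι] {p : ℝ} (hp : 0 < p) {W A : Matrix ι ι ℝ}
    (hW : W.IsSymm) (hA : A.IsHermitian)
    (hAW : ∀ i j, A i j = W i j + p - if i = j then p else 0)
    (hop : ∀ x, (W *ᵥ x) ⬝ᵥ (W *ᵥ x) ≤ (p * Fintype.card ι / 4) ^ 2 * (x ⬝ᵥ x)) :
    ∃ a₀ a₁ a₂ a : ℝ, 3 * p * Fintype.card ι / 4 ≤ sSup (spectrum ℝ A) + p ∧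
      sSup (spectrum ℝ A) + p = p * Fintype.card ι + a₀ ∧
      (sSup (spectrum ℝ A) + p) * a₀ = p * (1 ⬝ᵥ (W *ᵥ 1)) + a₁ ∧
      (sSup (spectrum ℝ A) + p) * a₁ = p * ((W *ᵥ 1) ⬝ᵥ (W *ᵥ 1)) + a₂ ∧
      (sSup (spectrum ℝ A) + p) * a₂ = p * ((W *ᵥ 1) ⬝ᵥ (W *ᵥ (W *ᵥ 1))) + a ∧
      |a| ≤ 2 * ((W *ᵥ (W *ᵥ 1)) ⬝ᵥ (W *ᵥ (W *ᵥ 1))) / Fintype.card ι := by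
  set N : ℝ := (Fintype.card ι : ℝ) with hN
  have hN0 : 0 < N := by rw [hN]; exact_mod_cast Fintype.card_pos
  have hone : (1 : ι → ℝ) ⬝ᵥ 1 = N := by simp [hN, dotProduct]
  have hAmul : ∀ x : ι → ℝ, A *ᵥ x = W *ᵥ x + (p * (1 ⬝ᵥ x)) • (1 : ι → ℝ) - p • x := by
    intro x
    ext i
    simp [mulVec, dotProduct, hAW, sub_mul, add_mul, sum_sub_distrib, sum_add_distrib, mul_sum]
  set θ := sSup (spectrum ℝ A) + p with hθ
  have hquad := abs_dotProduct_mulVec_le (by positivity) hop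
  have hθ34 : 3 * p * N / 4 ≤ θ := by
    have h1 := dotProduct_mulVec_le_sSup_spectrum hA 1
    rw [hAmul, dotProduct_sub, dotProduct_add, dotProduct_smul, dotProduct_smul, hone,
      smul_eq_mul, smul_eq_mul] at h1
    have h2 := (abs_le.1 (hquad 1)).1
    rw [hone] at h2
    have h3 : (3 * p * N / 4) * N ≤ θ * N := by
      rw [hθ]; nlinarith
    exact le_of_mul_le_mul_right h3 hN0
  obtain ⟨u, hu0, hu⟩ := exists_mulVec_eq_sSup_spectrum hA
  have huW : W *ᵥ u + (p * (1 ⬝ᵥ u)) • (1 : ι → ℝ) = θ • u := by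
    rw [hθ, add_smul, ← hu, hAmul]
    abel
  have hupos : 0 < u ⬝ᵥ u :=
    lt_of_le_of_ne (dotProduct_self_nonneg_real u) (Ne.symm (by simpa using hu0))
  have hs : (1 : ι → ℝ) ⬝ᵥ u ≠ 0 := by
    intro h
    rw [h, mul_zero, zero_smul, add_zero] at huW
    have h2 := (abs_le.1 (hquad u)).2
    rw [huW, dotProduct_smul, smul_eq_mul] at h2
    have := le_of_mul_le_mul_right h2 hupos
    nlinarith [mul_pos hp hN0]
  set s := (1 : ι → ℝ) ⬝ᵥ u with hs_def
  set v := s⁻¹ • u with hv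
  have hv1 : (1 : ι → ℝ) ⬝ᵥ v = 1 := by
    rw [hv, dotProduct_smul, ← hs_def, smul_eq_mul, inv_mul_cancel₀ hs]
  have hvW : θ • v = W *ᵥ v + p • (1 : ι → ℝ) := by
    rw [hv, smul_comm, ← huW, smul_add, mulVec_smul, smul_smul, mul_left_comm,
      inv_mul_cancel₀ hs, mul_one]
  have step : ∀ x : ι → ℝ, θ * (x ⬝ᵥ v) = p * (1 ⬝ᵥ x) + (W *ᵥ x) ⬝ᵥ v := by
    intro x
    rw [← smul_eq_mul θ, ← dotProduct_smul, hvW, dotProduct_add, dotProduct_smul,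
      dotProduct_mulVec_of_isSymm hW, dotProduct_comm x 1, smul_eq_mul, add_comm]
  set d := W *ᵥ (1 : ι → ℝ) with hd
  set y := W *ᵥ (W *ᵥ v) with hy
  refine ⟨d ⬝ᵥ v, (W *ᵥ d) ⬝ᵥ v, (W *ᵥ (W *ᵥ d)) ⬝ᵥ v, (W *ᵥ (W *ᵥ (W *ᵥ d))) ⬝ᵥ v,
    hθ34, ?_, step d, ?_, ?_, ?_⟩
  · have := step 1
    rwa [hv1, hone, mul_one] at this
  · rw [step, dotProduct_mulVec_of_isSymm hW 1 d]
  · rw [step, dotProduct_mulVec_of_isSymm hW 1 (W *ᵥ d)]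
  · have e : (W *ᵥ (W *ᵥ (W *ᵥ d))) ⬝ᵥ v = y ⬝ᵥ (W *ᵥ d) := by
      rw [← dotProduct_mulVec_of_isSymm hW, ← dotProduct_mulVec_of_isSymm hW, dotProduct_comm]
    have hyW : θ • y = W *ᵥ y + p • (W *ᵥ d) := by
      rw [hy, ← mulVec_smul, ← mulVec_smul, hvW, mulVec_add, mulVec_add,
        mulVec_smul W p 1, mulVec_smul W p]
    have h1 : θ * (y ⬝ᵥ y) = y ⬝ᵥ (W *ᵥ y) + p * (y ⬝ᵥ (W *ᵥ d)) := by
      rw [← smul_eq_mul, ← dotProduct_smul, hyW, dotProduct_add, dotProduct_smul, smul_eq_mul]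
    have h2 := (abs_le.1 (hquad y)).2
    have h3 := dotProduct_sq_le y (W *ᵥ d)
    have hyy := dotProduct_self_nonneg_real y
    have hK := dotProduct_self_nonneg_real (W *ᵥ d)
    rw [e]
    set z := y ⬝ᵥ (W *ᵥ d)
    set K := (W *ᵥ d) ⬝ᵥ (W *ᵥ d)
    have h4 : N / 2 * (y ⬝ᵥ y) ≤ z := by
      have : p * (N / 2 * (y ⬝ᵥ y)) ≤ p * z := by nlinarith
      exact le_of_mul_le_mul_left this hp
    have hz : 0 ≤ z := le_trans (by positivity) h4
    rw [abs_of_nonneg hz, le_div_iff₀ hN0]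
    rcases hz.eq_or_lt with h | h
    · rw [← h]; linarith
    · refine le_of_mul_le_mul_left ?_ h
      nlinarith

lemma abs_sSup_spectrum_sub_expansion_le [Nonempty ι] {p : ℝ} (hp : p ∈ Set.Ioo (0 : ℝ) 1)
    {W A : Matrix ι ι ℝ} (hW : W.IsSymm) (hA : A.IsHermitian)
    (hAW : ∀ i j, A i j = W i j + p - if i = j then p else 0)
    (hop : ∀ x, (W *ᵥ x) ⬝ᵥ (W *ᵥ x) ≤ (p * Fintype.card ι / 4) ^ 2 * (x ⬝ᵥ x)) :
    |sSup (spectrum ℝ A) + p - p * Fintype.card ι - (1 ⬝ᵥ (W *ᵥ 1)) / Fintype.card ι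
      - ((W *ᵥ 1) ⬝ᵥ (W *ᵥ 1)) / (p * Fintype.card ι ^ 2)
      - ((W *ᵥ 1) ⬝ᵥ (W *ᵥ (W *ᵥ 1))) / (p ^ 2 * Fintype.card ι ^ 3)| ≤
    52 * (2 / p) ^ 6 * (((W *ᵥ (W *ᵥ 1)) ⬝ᵥ (W *ᵥ (W *ᵥ 1))) / Fintype.card ι ^ 4
      + (1 ⬝ᵥ (W *ᵥ 1)) ^ 2 / Fintype.card ι ^ 3) := by
  obtain ⟨hp0, hp1⟩ := hp
  obtain ⟨a₀, a₁, a₂, a, hθ, h0, h1, h2, h3, ha⟩ :=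
    exists_resolvent_expansion hp0 hW hA hAW hop
  have hone : (1 : ι → ℝ) ⬝ᵥ 1 = Fintype.card ι := by simp [dotProduct]
  have hD := dotProduct_self_nonneg_real (W *ᵥ 1)
  have hK := dotProduct_self_nonneg_real (W *ᵥ (W *ᵥ 1))
  have hKD := hop (W *ᵥ 1)
  have hDK := dotProduct_sq_le 1 (W *ᵥ (W *ᵥ 1))
  rw [dotProduct_mulVec_of_isSymm hW, hone] at hDK
  have hQ := dotProduct_sq_le (W *ᵥ 1) (W *ᵥ (W *ᵥ 1))
  set N : ℝ := (Fintype.card ι : ℝ) with hN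
  have hN0 : 0 < N := by rw [hN]; exact_mod_cast Fintype.card_pos
  set S := (1 : ι → ℝ) ⬝ᵥ (W *ᵥ 1)
  set D := (W *ᵥ 1) ⬝ᵥ (W *ᵥ 1)
  set Q := (W *ᵥ 1) ⬝ᵥ (W *ᵥ (W *ᵥ 1))
  set K := (W *ᵥ (W *ᵥ 1)) ⬝ᵥ (W *ᵥ (W *ᵥ 1))
  set θ := sSup (spectrum ℝ A) + p
  have hθ0 : 0 < θ := lt_of_lt_of_le (by positivity) hθ
  have hKD' : K ≤ N ^ 2 * D := hKD.trans (by gcongr; nlinarith)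
  have hQD : |Q| ≤ N * D := by
    refine abs_le_of_sq_le_sq (hQ.trans ?_) (by positivity)
    nlinarith
  have key := abs_sub_expansion_le (p := p) (N := N) (t := θ / N) (σ := S / N) (Δ := D / N ^ 2)
    (q := Q / N ^ 3) (κ := K / N ^ 4) (r := a / θ ^ 3) (δ := θ - p * N) ⟨hp0, hp1⟩ hN0
    (by rw [le_div_iff₀ hN0]; linarith) (by field_simp) ?_ ?_ (by positivity) ?_ ?_ ?_
  · calc _ = |θ - p * N - S / N - D / N ^ 2 / p - Q / N ^ 3 / p ^ 2| := by
          rw [div_div, div_div, mul_comm (N ^ 2), mul_comm (N ^ 3)]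
      _ ≤ _ := key
      _ = _ := by
        congr 2
        field_simp
  · have e1 : a₂ = (p * Q + a) / θ := by rw [eq_div_iff hθ0.ne']; linarith
    have e2 : a₁ = (p * D + a₂) / θ := by rw [eq_div_iff hθ0.ne']; linarith
    have e3 : a₀ = (p * S + a₁) / θ := by rw [eq_div_iff hθ0.ne']; linarith
    rw [h0, add_sub_cancel_left, ← h0, e3, e2, e1]
    field_simp
    ring
  · rw [abs_div, abs_of_pos (by positivity : 0 < θ ^ 3)]
    calc |a| / θ ^ 3 ≤ 2 * K / N / θ ^ 3 := by gcongr
      _ = _ := by field_simp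
  · rw [div_le_div_iff₀ (by positivity) (by positivity)]
    nlinarith [pow_pos hN0 2]
  · rw [abs_div, abs_of_pos (by positivity : 0 < N ^ 3), div_le_div_iff₀ (by positivity)
      (by positivity)]
    nlinarith [pow_pos hN0 2]
  · rw [div_pow, ← mul_div_assoc, div_le_div_iff₀ (by positivity) (by positivity)]
    calc D ^ 2 * N ^ 4 ≤ (N * K) * N ^ 4 := by gcongr
      _ = _ := by ring

lemma abs_sSup_spectrum_sub_expansion_le_card [Nonempty ι] {p : ℝ} (hp : p ∈ Set.Ioo (0 : ℝ) 1)
    {W A : Matrix ι ι ℝ} (hA : A.IsHermitian)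
    (hW1 : ∀ i j, |W i j| ≤ 1) (hA1 : ∀ i j, |A i j| ≤ 1) :
    |sSup (spectrum ℝ A) + p - p * Fintype.card ι - (1 ⬝ᵥ (W *ᵥ 1)) / Fintype.card ι
      - ((W *ᵥ 1) ⬝ᵥ (W *ᵥ 1)) / (p * Fintype.card ι ^ 2)
      - ((W *ᵥ 1) ⬝ᵥ (W *ᵥ (W *ᵥ 1))) / (p ^ 2 * Fintype.card ι ^ 3)| ≤
    (4 + 1 / p + 1 / p ^ 2) * Fintype.card ι := by
  obtain ⟨hp0, hp1⟩ := hp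
  have hθ := abs_sSup_spectrum_le hA hA1
  have hone : (1 : ι → ℝ) ⬝ᵥ 1 = Fintype.card ι := by simp [dotProduct]
  have hop : ∀ x, (W *ᵥ x) ⬝ᵥ (W *ᵥ x) ≤ (Fintype.card ι : ℝ) ^ 2 * (x ⬝ᵥ x) := by
    intro x
    have hx := dotProduct_self_nonneg_real x
    refine (mulVec_dotProduct_self_le W x).trans ?_
    gcongr
    calc _ ≤ ∑ i : ι, ∑ j : ι, (1 : ℝ) := by
          gcongr with i _ j _
          exact (sq_le_one_iff_abs_le_one _).2 (hW1 i j)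
      _ = _ := by simp [sq]
  have hS := abs_dotProduct_mulVec_le (by positivity) hop 1
  have hQ := abs_dotProduct_mulVec_le (by positivity) hop (W *ᵥ 1)
  have hD := hop 1
  have hD0 := dotProduct_self_nonneg_real (W *ᵥ 1)
  rw [hone] at hS hD
  set N : ℝ := (Fintype.card ι : ℝ) with hN
  have hN1 : 1 ≤ N := by rw [hN]; exact_mod_cast Fintype.card_pos
  have hN0 : 0 < N := by linarith
  set S := (1 : ι → ℝ) ⬝ᵥ (W *ᵥ 1)
  set D := (W *ᵥ 1) ⬝ᵥ (W *ᵥ 1)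
  set Q := (W *ᵥ 1) ⬝ᵥ (W *ᵥ (W *ᵥ 1))
  have b1 : |S / N| ≤ N := by
    rw [abs_div, abs_of_pos hN0, div_le_iff₀ hN0]; exact hS
  have b2 : |D / (p * N ^ 2)| ≤ 1 / p * N := by
    rw [abs_of_nonneg (by positivity), div_le_iff₀ (by positivity)]
    calc D ≤ N ^ 2 * N := hD
      _ = _ := by field_simp
  have b3 : |Q / (p ^ 2 * N ^ 3)| ≤ 1 / p ^ 2 * N := by
    rw [abs_div, abs_of_pos (by positivity : 0 < p ^ 2 * N ^ 3), div_le_iff₀ (by positivity)]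
    calc |Q| ≤ N * D := hQ
      _ ≤ N * (N ^ 2 * N) := by gcongr
      _ = _ := by field_simp
  have hpN : p * N ≤ N := by nlinarith
  have hpN0 : 0 < p * N := by positivity
  rw [abs_le] at *
  constructor <;> linarith [b1.1, b1.2, b2.1, b2.2, b3.1, b3.2, hθ.1, hθ.2]

end Expansion

section BernoulliProduct

variable {ι : Type*}

lemma DependsOn.real_mul {F G : (ι → Bool) → ℝ} {D : Set ι}
    (hF : DependsOn F D) (hG : DependsOn G D) : DependsOn (fun ω => F ω * G ω) D :=
  fun _ _ h => congrArg₂ _ (hF h) (hG h)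

variable [Fintype ι]

/-- The expectation of `F` under independent Bernoulli(`p`) bits indexed by `ι`. -/
noncomputable def bernExp (p : ℝ) (F : (ι → Bool) → ℝ) : ℝ :=
  ∑ ω, (∏ i, if ω i then p else 1 - p) * F ω

lemma bernExp_add (p : ℝ) (F G : (ι → Bool) → ℝ) :
    bernExp p (fun ω => F ω + G ω) = bernExp p F + bernExp p G := by
  simp [bernExp, mul_add, sum_add_distrib]

lemma bernExp_sub (p : ℝ) (F G : (ι → Bool) → ℝ) :
    bernExp p (fun ω => F ω - G ω) = bernExp p F - bernExp p G := by
  simp [bernExp, mul_sub, sum_sub_distrib]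

lemma bernExp_const_mul (p c : ℝ) (F : (ι → Bool) → ℝ) :
    bernExp p (fun ω => c * F ω) = c * bernExp p F := by
  simp [bernExp, mul_sum, mul_left_comm]

lemma bernExp_div_const (p c : ℝ) (F : (ι → Bool) → ℝ) :
    bernExp p (fun ω => F ω / c) = bernExp p F / c := by
  simp [bernExp, sum_div, mul_div_assoc]

lemma bernExp_sum {κ : Type*} (p : ℝ) (s : Finset κ) (F : κ → (ι → Bool) → ℝ) :
    bernExp p (fun ω => ∑ k ∈ s, F k ω) = ∑ k ∈ s, bernExp p (F k) := by
  simp only [bernExp, mul_sum]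
  exact sum_comm

lemma bernExp_apply (p : ℝ) (i : ι) (f : Bool → ℝ) :
    bernExp p (fun ω => f (ω i)) = p * f true + (1 - p) * f false := by
  have h : ∀ ω : ι → Bool, (∏ j, if ω j then p else 1 - p) * f (ω i) =
      ∏ j, (if ω j then p else 1 - p) * (if j = i then f (ω j) else 1) := by
    intro ω
    rw [prod_mul_distrib, prod_ite_eq' univ i (fun j => f (ω j))]
    simp
  simp only [bernExp, h]
  rw [← Fintype.prod_sum
    (fun (j : ι) (b : Bool) => (if b then p else 1 - p) * (if j = i then f b else 1))]
  rw [Fintype.prod_eq_single i]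
  · simp
  · intro j hj
    simp [hj]

lemma bernExp_const (p c : ℝ) : bernExp p (fun _ : ι → Bool => c) = c := by
  have h : bernExp p (fun _ : ι → Bool => (1 : ℝ)) = 1 := by
    simp only [bernExp, mul_one]
    rw [← Fintype.prod_sum (fun (_ : ι) (b : Bool) => (if b then p else 1 - p))]
    simp
  simpa [h] using bernExp_const_mul p c (fun _ : ι → Bool => (1 : ℝ))

lemma bernExp_mono {p : ℝ} (hp : p ∈ Set.Ioo (0 : ℝ) 1) {F G : (ι → Bool) → ℝ}
    (h : ∀ ω, F ω ≤ G ω) : bernExp p F ≤ bernExp p G := by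
  refine sum_le_sum fun ω _ => mul_le_mul_of_nonneg_left (h ω) (prod_nonneg fun i _ => ?_)
  have := hp.1
  have := hp.2
  split_ifs <;> linarith

lemma abs_bernExp_le {p : ℝ} (hp : p ∈ Set.Ioo (0 : ℝ) 1) {F G : (ι → Bool) → ℝ}
    (h : ∀ ω, |F ω| ≤ G ω) : |bernExp p F| ≤ bernExp p G := by
  rw [abs_le]
  constructor
  · have := bernExp_mono hp (F := fun ω => (-1) * G ω) (G := F)
      fun ω => by linarith [abs_le.1 (h ω)]
    rw [bernExp_const_mul] at this
    linarith
  · exact bernExp_mono hp fun ω => (abs_le.1 (h ω)).2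

lemma DependsOn.mul_compl_bernExp (p : ℝ) {F G : (ι → Bool) → ℝ} {D : Set ι}
    (hF : DependsOn F D) (hG : DependsOn G Dᶜ) :
    bernExp p (fun ω => F ω * G ω) = bernExp p F * bernExp p G := by
  let e := Equiv.piEquivPiSubtypeProd (· ∈ D) (fun _ : ι => Bool)
  let w : Bool → ℝ := fun b => if b then p else 1 - p
  have key : ∀ H : (ι → Bool) → ℝ, bernExp p H =
      ∑ a : {i // i ∈ D} → Bool, ∑ b : {i // i ∉ D} → Bool,
        (∏ i, w (a i)) * (∏ i, w (b i)) * H (e.symm (a, b)) := by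
    intro H
    rw [← Fintype.sum_prod_type', bernExp, ← Equiv.sum_comp e.symm]
    refine sum_congr rfl fun ab _ => ?_
    congr 1
    rw [← Fintype.prod_subtype_mul_prod_subtype (· ∈ D)]
    congr 1 <;> refine prod_congr rfl fun i _ => ?_
    · simp [e, w, Equiv.piEquivPiSubtypeProd, i.2]
    · simp [e, w, Equiv.piEquivPiSubtypeProd, i.2]
  let a₀ : {i // i ∈ D} → Bool := fun _ => true
  let b₀ : {i // i ∉ D} → Bool := fun _ => true
  have hF' : ∀ a b, F (e.symm (a, b)) = F (e.symm (a, b₀)) := fun a b => hF fun i hi => by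
    simp [e, Equiv.piEquivPiSubtypeProd, hi]
  have hG' : ∀ a b, G (e.symm (a, b)) = G (e.symm (a₀, b)) := fun a b => hG fun i hi => by
    have hi : i ∉ D := hi
    simp [e, Equiv.piEquivPiSubtypeProd, hi]
  have hone₁ : ∑ a : {i // i ∈ D} → Bool, ∏ i, w (a i) = 1 := by
    rw [← Fintype.prod_sum (fun _ b => w b)]
    simp [w]
  have hone₂ : ∑ b : {i // i ∉ D} → Bool, ∏ i, w (b i) = 1 := by
    rw [← Fintype.prod_sum (fun _ b => w b)]
    simp [w]
  have eF : bernExp p F = ∑ a, (∏ i, w (a i)) * F (e.symm (a, b₀)) := by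
    rw [key]
    refine sum_congr rfl fun a _ => ?_
    calc _ = (∑ b : {i // i ∉ D} → Bool, ∏ i, w (b i)) *
          ((∏ i, w (a i)) * F (e.symm (a, b₀))) := by
          rw [sum_mul]
          exact sum_congr rfl fun b _ => by rw [hF']; ring
      _ = _ := by
          rw [hone₂, one_mul]
  have eG : bernExp p G = ∑ b, (∏ i, w (b i)) * G (e.symm (a₀, b)) := by
    rw [key, sum_comm]
    refine sum_congr rfl fun b _ => ?_
    calc _ = (∑ a : {i // i ∈ D} → Bool, ∏ i, w (a i)) *
          ((∏ i, w (b i)) * G (e.symm (a₀, b))) := by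
          rw [sum_mul]
          exact sum_congr rfl fun a _ => by rw [hG']; ring
      _ = _ := by
          rw [hone₁, one_mul]
  rw [eF, eG, key, sum_mul_sum]
  refine sum_congr rfl fun a _ => sum_congr rfl fun b _ => ?_
  rw [hF', hG']
  ring

end BernoulliProduct

section RandomMatrix

open Matrix

variable {V : Type*} [DecidableEq V]

/-- The unordered pairs of distinct vertices. -/
abbrev PotentialEdge (V : Type*) := {e : Sym2 V // ¬ e.IsDiag}

/-- The centered adjacency matrix of the graph encoded by `ω`. -/
noncomputable def noise (p : ℝ) (ω : PotentialEdge V → Bool) : Matrix V V ℝ := fun i j =>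
  if h : i = j then 0 else if ω ⟨s(i, j), by simpa using h⟩ then 1 - p else -p

lemma noise_self (p : ℝ) (ω : PotentialEdge V → Bool) (i : V) : noise p ω i i = 0 := by
  simp [noise]

lemma noise_symm (p : ℝ) (ω : PotentialEdge V → Bool) (i j : V) :
    noise p ω i j = noise p ω j i := by
  simp only [noise, eq_comm (a := i) (b := j), Sym2.eq_swap (a := i) (b := j)]

lemma noise_isSymm (p : ℝ) (ω : PotentialEdge V → Bool) : (noise p ω).IsSymm :=
  Matrix.IsSymm.ext fun i j => noise_symm p ω j i

lemma abs_noise_le_one {p : ℝ} (hp : p ∈ Set.Ioo (0 : ℝ) 1) (ω : PotentialEdge V → Bool)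
    (i j : V) : |noise p ω i j| ≤ 1 := by
  obtain ⟨hp0, hp1⟩ := hp
  rw [noise, abs_le]
  split_ifs <;> constructor <;> linarith

lemma dependsOn_noise (p : ℝ) (i j : V) :
    DependsOn (fun ω => noise p ω i j) {e : PotentialEdge V | e.1 = s(i, j)} := by
  intro ω ω' h
  by_cases hij : i = j
  · simp [noise, hij]
  · simp only [noise, hij, dite_false]
    rw [h _ (by simp)]

lemma dependsOn_noise_compl (p : ℝ) {i j k l : V} (h : s(k, l) ≠ s(i, j)) :
    DependsOn (fun ω => noise p ω k l) {e : PotentialEdge V | e.1 = s(i, j)}ᶜ :=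
  (dependsOn_noise p k l).mono fun e he he' => h (by
    rw [Set.mem_ofPred_eq] at he he'
    rw [← he, he'])

variable [Fintype V]

lemma bernExp_noise (p : ℝ) (i j : V) : bernExp p (fun ω => noise p ω i j) = 0 := by
  by_cases hij : i = j
  · simp [noise, hij, bernExp_const]
  · simp only [noise, hij, dite_false]
    rw [bernExp_apply p _ (fun b => if b then 1 - p else -p)]
    simp
    ring

lemma bernExp_noise_sq (p : ℝ) {i j : V} (hij : i ≠ j) :
    bernExp p (fun ω => noise p ω i j * noise p ω i j) = p * (1 - p) := by
  simp only [noise, hij, dite_false]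
  rw [bernExp_apply p _ (fun b => (if b then 1 - p else -p) * (if b then 1 - p else -p))]
  simp
  ring

lemma bernExp_noise_mul_eq_zero (p : ℝ) (i j : V) {F : (PotentialEdge V → Bool) → ℝ}
    (hF : DependsOn F {e : PotentialEdge V | e.1 = s(i, j)}ᶜ) :
    bernExp p (fun ω => noise p ω i j * F ω) = 0 := by
  rw [(dependsOn_noise p i j).mul_compl_bernExp p hF, bernExp_noise, zero_mul]

lemma bernExp_noise_mul_noise (p : ℝ) {i j k l : V} (h : s(k, l) ≠ s(i, j)) :
    bernExp p (fun ω => noise p ω i j * noise p ω k l) = 0 :=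
  bernExp_noise_mul_eq_zero p i j (dependsOn_noise_compl p h)

lemma abs_bernExp_le_one {p : ℝ} (hp : p ∈ Set.Ioo (0 : ℝ) 1)
    {F : (PotentialEdge V → Bool) → ℝ} (h : ∀ ω, |F ω| ≤ 1) : |bernExp p F| ≤ 1 := by
  simpa only [bernExp_const] using abs_bernExp_le hp h

lemma one_dotProduct_noise_mulVec (p : ℝ) (ω : PotentialEdge V → Bool) :
    1 ⬝ᵥ (noise p ω *ᵥ 1) = ∑ i, ∑ j, noise p ω i j := by
  simp [dotProduct, mulVec]

lemma bernExp_sum_noise (p : ℝ) :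
    bernExp p (fun ω => 1 ⬝ᵥ (noise (V := V) p ω *ᵥ 1)) = 0 := by
  simp only [one_dotProduct_noise_mulVec, bernExp_sum, bernExp_noise, sum_const_zero]

lemma bernExp_sum_noise_sq_le {p : ℝ} (hp : p ∈ Set.Ioo (0 : ℝ) 1) :
    bernExp p (fun ω => (1 ⬝ᵥ (noise (V := V) p ω *ᵥ 1)) ^ 2) ≤ 2 * Fintype.card V ^ 2 := by
  have e : ∀ ω, (1 ⬝ᵥ (noise (V := V) p ω *ᵥ 1)) ^ 2 =
      ∑ i, ∑ j, ∑ k, ∑ l, noise p ω i j * noise p ω k l := by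
    intro ω
    rw [one_dotProduct_noise_mulVec, sq]
    simp_rw [sum_mul, mul_sum]
  simp only [e, bernExp_sum]
  calc _ ≤ ∑ i : V, ∑ j : V, ∑ k : V, ∑ l : V,
        (((if k = i then if l = j then 1 else 0 else 0) +
          (if k = j then if l = i then 1 else 0 else 0) : ℝ)) := by
        gcongr with i _ j _ k _ l _
        by_cases h : s(k, l) = s(i, j)
        · have h1 : bernExp p (fun ω => noise p ω i j * noise p ω k l) ≤ 1 :=
            (abs_le.1 (abs_bernExp_le_one hp fun ω => by
              rw [abs_mul]
              exact mul_le_one₀ (abs_noise_le_one hp ω _ _) (abs_nonneg _)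
                (abs_noise_le_one hp ω _ _))).2
          refine h1.trans ?_
          rw [Sym2.eq_iff] at h
          rcases h with ⟨rfl, rfl⟩ | ⟨rfl, rfl⟩ <;> (simp; split_ifs <;> norm_num)
        · rw [bernExp_noise_mul_noise p h]
          split_ifs <;> norm_num
    _ = _ := by
      simp [sum_add_distrib]
      ring

lemma bernExp_sum_degree_sq (p : ℝ) :
    bernExp p (fun ω => (noise (V := V) p ω *ᵥ 1) ⬝ᵥ (noise p ω *ᵥ 1)) =
      Fintype.card V * (Fintype.card V - 1) * (p * (1 - p)) := by
  have e : ∀ ω, (noise (V := V) p ω *ᵥ 1) ⬝ᵥ (noise p ω *ᵥ 1) =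
      ∑ i, ∑ j, ∑ k, noise p ω i j * noise p ω i k := by
    intro ω
    simp only [dotProduct, mulVec, Pi.one_apply, mul_one]
    simp_rw [sum_mul, mul_sum]
  simp only [e, bernExp_sum]
  have h : ∀ i j k : V, bernExp p (fun ω => noise p ω i j * noise p ω i k) =
      if k = j then (p * (1 - p) - if i = j then p * (1 - p) else 0) else 0 := by
    intro i j k
    split_ifs with h1 h2
    · subst h1 h2
      simp [noise_self, bernExp_const]
    · subst h1
      rw [bernExp_noise_sq p h2, sub_zero]
    · refine bernExp_noise_mul_noise p ?_
      simpa using fun h => h1 (Sym2.congr_right.1 h)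
  simp only [h]
  simp [sum_sub_distrib]
  ring

lemma abs_bernExp_degree_dotProduct_le {p : ℝ} (hp : p ∈ Set.Ioo (0 : ℝ) 1) :
    |bernExp p (fun ω => (noise (V := V) p ω *ᵥ 1) ⬝ᵥ (noise p ω *ᵥ (noise p ω *ᵥ 1)))| ≤
      Fintype.card V ^ 2 := by
  have e : ∀ ω, (noise (V := V) p ω *ᵥ 1) ⬝ᵥ (noise p ω *ᵥ (noise p ω *ᵥ 1)) =
      ∑ i, ∑ k, ∑ j, ∑ l, noise p ω i k * (noise p ω i j * noise p ω j l) := by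
    intro ω
    simp only [dotProduct, mulVec, Pi.one_apply, mul_one]
    simp_rw [sum_mul, mul_sum]
  simp only [e, bernExp_sum]
  calc _ ≤ ∑ i : V, ∑ k : V, ∑ j : V, ∑ l : V,
        (if j = k then if l = i then (1 : ℝ) else 0 else 0) := by
        refine (abs_sum_le_sum_abs _ _).trans (sum_le_sum fun i _ => ?_)
        refine (abs_sum_le_sum_abs _ _).trans (sum_le_sum fun k _ => ?_)
        refine (abs_sum_le_sum_abs _ _).trans (sum_le_sum fun j _ => ?_)
        refine (abs_sum_le_sum_abs _ _).trans (sum_le_sum fun l _ => ?_)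
        by_cases hij : i = j
        · subst hij
          simp only [noise_self, zero_mul, mul_zero, bernExp_const, abs_zero]
          split_ifs <;> norm_num
        by_cases hjk : j = k
        · by_cases hli : l = i
          · simp only [hjk, hli, if_true]
            refine abs_bernExp_le_one hp fun ω => ?_
            rw [abs_mul, abs_mul]
            exact mul_le_one₀ (abs_noise_le_one hp ω _ _) (by positivity)
              (mul_le_one₀ (abs_noise_le_one hp ω _ _) (abs_nonneg _)
                (abs_noise_le_one hp ω _ _))
          · have e2 : ∀ ω, noise p ω i k * (noise p ω i j * noise p ω j l) =
                noise p ω j l * (noise p ω i k * noise p ω i j) := fun ω => by ring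
            simp only [e2]
            rw [bernExp_noise_mul_eq_zero]
            · simp [hli]
            · exact (dependsOn_noise_compl p (by grind [Sym2.eq_iff])).real_mul
                (dependsOn_noise_compl p (by grind [Sym2.eq_iff]))
        · rw [bernExp_noise_mul_eq_zero]
          · simp [hjk]
          · exact (dependsOn_noise_compl p (by grind [Sym2.eq_iff])).real_mul
              (dependsOn_noise_compl p (by grind [Sym2.eq_iff]))
    _ = _ := by
      simp
      ring

lemma bernExp_offDiag_walk_sq_le {p : ℝ} (hp : p ∈ Set.Ioo (0 : ℝ) 1) (i : V) :
    bernExp p (fun ω => (∑ j, ∑ k, if k = i then 0 else noise p ω i j * noise p ω j k) ^ 2) ≤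
      Fintype.card V ^ 2 := by
  have e : ∀ ω, (∑ j, ∑ k, if k = i then 0 else noise (V := V) p ω i j * noise p ω j k) ^ 2 =
      ∑ j, ∑ k, ∑ j', ∑ k', (if k = i then 0 else noise p ω i j * noise p ω j k) *
        (if k' = i then 0 else noise p ω i j' * noise p ω j' k') := by
    intro ω
    rw [sq]
    simp_rw [sum_mul, mul_sum]
  simp only [e, bernExp_sum]
  calc _ ≤ ∑ j : V, ∑ k : V, ∑ j' : V, ∑ k' : V,
        (if j' = j then if k' = k then (1 : ℝ) else 0 else 0) := by
        gcongr with j _ k _ j' _ k' _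
        by_cases hk : k = i
        · simp only [hk, if_true, zero_mul, bernExp_const]
          split_ifs <;> norm_num
        by_cases hk' : k' = i
        · simp only [hk', if_true, mul_zero, bernExp_const]
          split_ifs <;> norm_num
        by_cases hj : i = j
        · simp only [← hj, noise_self, zero_mul, ite_self, bernExp_const]
          split_ifs <;> norm_num
        by_cases hj' : i = j'
        · simp only [← hj', noise_self, zero_mul, mul_zero, ite_self, bernExp_const]
          split_ifs <;> norm_num
        simp only [hk, hk', if_false]
        by_cases hjj : j' = j
        · by_cases hkk : k' = k
          · simp only [hjj, hkk, if_true]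
            refine (abs_le.1 (abs_bernExp_le_one hp fun ω => ?_)).2
            have h1 : |noise p ω i j * noise p ω j k| ≤ 1 := by
              rw [abs_mul]
              exact mul_le_one₀ (abs_noise_le_one hp ω _ _) (abs_nonneg _)
                (abs_noise_le_one hp ω _ _)
            rw [abs_mul]
            exact mul_le_one₀ h1 (abs_nonneg _) h1
          · have e2 : ∀ ω, noise p ω i j * noise p ω j k * (noise p ω i j' * noise p ω j' k') =
                noise p ω j k * (noise p ω i j * (noise p ω i j' * noise p ω j' k')) :=
              fun ω => by ring
            simp only [e2]
            rw [bernExp_noise_mul_eq_zero]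
            · simp [hkk]
            · exact (dependsOn_noise_compl p (by grind [Sym2.eq_iff])).real_mul
                ((dependsOn_noise_compl p (by grind [Sym2.eq_iff])).real_mul
                  (dependsOn_noise_compl p (by grind [Sym2.eq_iff])))
        · simp only [mul_assoc]
          rw [bernExp_noise_mul_eq_zero]
          · simp [hjj]
          · exact (dependsOn_noise_compl p (by grind [Sym2.eq_iff])).real_mul
              ((dependsOn_noise_compl p (by grind [Sym2.eq_iff])).real_mul
                (dependsOn_noise_compl p (by grind [Sym2.eq_iff])))
    _ = _ := by
      simp
      ring

lemma bernExp_walk_sq_le {p : ℝ} (hp : p ∈ Set.Ioo (0 : ℝ) 1) :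
    bernExp p (fun ω => (noise (V := V) p ω *ᵥ (noise p ω *ᵥ 1)) ⬝ᵥ
      (noise p ω *ᵥ (noise p ω *ᵥ 1))) ≤ 4 * Fintype.card V ^ 3 := by
  have e : ∀ ω (i : V), (noise p ω *ᵥ (noise p ω *ᵥ 1)) i = (∑ j, noise p ω i j ^ 2) +
      ∑ j, ∑ k, if k = i then 0 else noise p ω i j * noise p ω j k := by
    intro ω i
    simp only [dotProduct, mulVec, Pi.one_apply, mul_one]
    rw [← sum_add_distrib]
    refine sum_congr rfl fun j _ => ?_
    rw [mul_sum, ← add_sum_erase univ _ (mem_univ i), noise_symm p ω j i, sq]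
    congr 1
    rw [← add_sum_erase univ (fun k => if k = i then 0 else _) (mem_univ i), if_pos rfl, zero_add]
    exact sum_congr rfl fun k hk => by rw [if_neg (ne_of_mem_erase hk)]
  have hb : ∀ ω, (noise (V := V) p ω *ᵥ (noise p ω *ᵥ 1)) ⬝ᵥ
      (noise p ω *ᵥ (noise p ω *ᵥ 1)) ≤ ∑ i, (2 * (Fintype.card V : ℝ) ^ 2 +
        2 * (∑ j, ∑ k, if k = i then 0 else noise p ω i j * noise p ω j k) ^ 2) := by
    intro ω
    rw [dotProduct]
    gcongr with i _
    rw [e]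
    have h0 : 0 ≤ ∑ j, noise p ω i j ^ 2 := sum_nonneg fun j _ => sq_nonneg _
    have h1 : ∑ j, noise p ω i j ^ 2 ≤ Fintype.card V := by
      calc _ ≤ ∑ j : V, (1 : ℝ) := by
            gcongr with j _
            exact (sq_le_one_iff_abs_le_one _).2 (abs_noise_le_one hp ω i j)
        _ = _ := by simp
    have h2 := pow_le_pow_left₀ h0 h1 2
    set a := ∑ j, noise p ω i j ^ 2
    set b := ∑ j, ∑ k, if k = i then 0 else noise p ω i j * noise p ω j k
    nlinarith [sq_nonneg (a - b)]
  refine (bernExp_mono hp hb).trans ?_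
  simp only [bernExp_sum, bernExp_add, bernExp_const, bernExp_const_mul]
  calc _ ≤ ∑ i : V, (2 * (Fintype.card V : ℝ) ^ 2 + 2 * (Fintype.card V : ℝ) ^ 2) := by
        gcongr with i _
        exact bernExp_offDiag_walk_sq_le hp i
    _ = _ := by
      simp
      ring

lemma bernExp_exp_noise_mul_noise_le {p : ℝ} (hp : p ∈ Set.Ioo (0 : ℝ) 1) {s : ℝ} (hs : |s| ≤ 1)
    {i j : V} (hij : i ≠ j) (k : V) :
    bernExp p (fun ω => Real.exp (s * (noise p ω i k * noise p ω k j))) ≤ Real.exp (s ^ 2) := by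
  have hW : ∀ ω, |noise p ω i k * noise p ω k j| ≤ 1 := fun ω => by
    rw [abs_mul]
    exact mul_le_one₀ (abs_noise_le_one hp ω _ _) (abs_nonneg _) (abs_noise_le_one hp ω _ _)
  have h1 : ∀ ω, Real.exp (s * (noise p ω i k * noise p ω k j)) ≤
      (1 + s ^ 2) + s * (noise p ω i k * noise p ω k j) := by
    intro ω
    have hx : |s * (noise p ω i k * noise p ω k j)| ≤ |s| := by
      rw [abs_mul]
      exact mul_le_of_le_one_right (abs_nonneg _) (hW ω)
    have h2 := (abs_le.1 (Real.abs_exp_sub_one_sub_id_le (hx.trans hs))).2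
    have h3 := sq_le_sq.2 hx
    linarith
  refine (bernExp_mono hp h1).trans ?_
  rw [bernExp_add, bernExp_const, bernExp_const_mul]
  have h0 : bernExp p (fun ω => noise p ω i k * noise p ω k j) = 0 := by
    refine bernExp_noise_mul_noise p fun h => ?_
    rw [Sym2.eq_swap (a := i)] at h
    exact hij (Sym2.congr_right.1 h).symm
  rw [h0, mul_zero, add_zero, add_comm]
  exact Real.add_one_le_exp _

lemma bernExp_exp_noise_sq_le {p : ℝ} (hp : p ∈ Set.Ioo (0 : ℝ) 1) {s : ℝ} (hs : |s| ≤ 1)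
    {i j : V} (hij : i ≠ j) :
    bernExp p (fun ω => Real.exp (s * (noise p ω * noise p ω) i j)) ≤
      Real.exp (Fintype.card V * s ^ 2) := by
  have key : ∀ K : Finset V, bernExp p (fun ω => ∏ k ∈ K,
      Real.exp (s * (noise p ω i k * noise p ω k j))) ≤ Real.exp (s ^ 2) ^ #K := by
    intro K
    induction K using Finset.induction_on with
    | empty => simp [bernExp_const]
    | insert k K hk ih =>
      simp only [prod_insert hk]
      rw [card_insert_of_notMem hk, pow_succ']
      have h1 : (1 : ℝ) ≤ Real.exp (s ^ 2) := Real.one_le_exp (sq_nonneg s)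
      by_cases hki : k = i
      · simp only [hki, noise_self, zero_mul, mul_zero, Real.exp_zero, one_mul]
        exact ih.trans (le_mul_of_one_le_left (by positivity) h1)
      by_cases hkj : k = j
      · simp only [hkj, noise_self, mul_zero, Real.exp_zero, one_mul]
        exact ih.trans (le_mul_of_one_le_left (by positivity) h1)
      rw [DependsOn.mul_compl_bernExp p (D := {e : PotentialEdge V | k ∈ e.1})]
      · refine mul_le_mul (bernExp_exp_noise_mul_noise_le hp hs hij k) ih ?_ (by positivity)
        rw [← bernExp_const (ι := PotentialEdge V) p 0]
        exact bernExp_mono hp fun ω => by positivity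
      · intro ω ω' h
        have ha : noise p ω i k = noise p ω' i k :=
          (dependsOn_noise p i k).mono (t := {e : PotentialEdge V | k ∈ e.1})
            (fun e he => by rw [Set.mem_ofPred_eq] at *; simp [he]) h
        have hb : noise p ω k j = noise p ω' k j :=
          (dependsOn_noise p k j).mono (t := {e : PotentialEdge V | k ∈ e.1})
            (fun e he => by rw [Set.mem_ofPred_eq] at *; simp [he]) h
        beta_reduce
        rw [ha, hb]
      · intro ω ω' h
        refine prod_congr rfl fun l hl => ?_
        have hkl : k ≠ l := fun h => hk (h ▸ hl)
        have ha : noise p ω i l = noise p ω' i l :=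
          (dependsOn_noise p i l).mono (t := {e : PotentialEdge V | k ∈ e.1}ᶜ)
            (fun e he => by rw [Set.mem_compl_iff, Set.mem_ofPred_eq] at *; simp [he, hki, hkl]) h
        have hb : noise p ω l j = noise p ω' l j :=
          (dependsOn_noise p l j).mono (t := {e : PotentialEdge V | k ∈ e.1}ᶜ)
            (fun e he => by rw [Set.mem_compl_iff, Set.mem_ofPred_eq] at *; simp [he, hkj, hkl]) h
        rw [ha, hb]
  have h := key univ
  simp only [← Real.exp_sum, ← mul_sum, ← Real.exp_nat_mul, card_univ] at h
  exact h

/-- An exponential upper bound for the indicator that some off-diagonal entry of the square of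
the noise matrix exceeds `t * card V` in absolute value. -/
noncomputable def sqTail (p t : ℝ) (ω : PotentialEdge V → Bool) : ℝ :=
  ∑ i, ∑ j, if i = j then 0 else
    Real.exp (t / 2 * (noise p ω * noise p ω) i j - Fintype.card V * t ^ 2 / 2) +
      Real.exp (-(t / 2) * (noise p ω * noise p ω) i j - Fintype.card V * t ^ 2 / 2)

lemma sqTail_nonneg (p t : ℝ) (ω : PotentialEdge V → Bool) : 0 ≤ sqTail p t ω :=
  sum_nonneg fun i _ => sum_nonneg fun j _ => by split_ifs <;> positivity

lemma bernExp_sqTail_le {p : ℝ} (hp : p ∈ Set.Ioo (0 : ℝ) 1) {t : ℝ} (ht0 : 0 < t) (ht : t ≤ 1) :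
    bernExp p (sqTail (V := V) p t) ≤
      2 * Fintype.card V ^ 2 * Real.exp (-(t ^ 2 / 4 * Fintype.card V)) := by
  have hentry : ∀ i j : V, i ≠ j → ∀ s : ℝ, |s| ≤ 1 → s ^ 2 = t ^ 2 / 4 →
      bernExp p (fun ω => Real.exp (s * (noise p ω * noise p ω) i j
        - Fintype.card V * t ^ 2 / 2)) ≤ Real.exp (-(t ^ 2 / 4 * Fintype.card V)) := by
    intro i j hij s hs hst
    simp only [Real.exp_sub]
    rw [bernExp_div_const, div_le_iff₀ (Real.exp_pos _), ← Real.exp_add]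
    refine (bernExp_exp_noise_sq_le hp hs hij).trans_eq ?_
    rw [hst]
    ring_nf
  have habs : |t / 2| ≤ 1 := by rw [abs_le]; constructor <;> linarith
  change bernExp p (fun ω => sqTail p t ω) ≤ _
  simp only [sqTail, bernExp_sum]
  calc _ ≤ ∑ i : V, ∑ j : V, 2 * Real.exp (-(t ^ 2 / 4 * Fintype.card V)) := by
        gcongr with i _ j _
        by_cases hij : i = j
        · simp only [hij, if_true, bernExp_const]
          positivity
        · simp only [hij, if_false, bernExp_add]
          have h1 := hentry i j hij (t / 2) habs (by ring)
          have h2 := hentry i j hij (-(t / 2)) (by rwa [abs_neg]) (by ring)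
          linarith
    _ = _ := by
      simp
      ring

lemma abs_noise_sq_le_of_sqTail_lt_one {p t : ℝ} (ht : 0 < t) {ω : PotentialEdge V → Bool}
    (h : sqTail p t ω < 1) {i j : V} (hij : i ≠ j) :
    |(noise p ω * noise p ω) i j| ≤ t * Fintype.card V := by
  set X := (noise p ω * noise p ω) i j with hX
  have hle : Real.exp (t / 2 * X - Fintype.card V * t ^ 2 / 2) +
      Real.exp (-(t / 2) * X - Fintype.card V * t ^ 2 / 2) ≤ sqTail p t ω := by
    have hnn : ∀ i j : V, 0 ≤ if i = j then 0 else
        Real.exp (t / 2 * (noise p ω * noise p ω) i j - Fintype.card V * t ^ 2 / 2) +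
        Real.exp (-(t / 2) * (noise p ω * noise p ω) i j - Fintype.card V * t ^ 2 / 2) :=
      fun i j => by split_ifs <;> positivity
    have h1 := single_le_sum (fun j _ => hnn i j) (mem_univ j)
    have h2 := single_le_sum (fun i _ => sum_nonneg fun j (_ : j ∈ univ) => hnn i j) (mem_univ i)
    rw [if_neg hij] at h1
    exact h1.trans h2
  have e1 := Real.exp_lt_one_iff.1
    (((le_add_of_nonneg_right (Real.exp_nonneg _)).trans hle).trans_lt h)
  have e2 := Real.exp_lt_one_iff.1
    (((le_add_of_nonneg_left (Real.exp_nonneg _)).trans hle).trans_lt h)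
  rw [abs_le]
  constructor <;> nlinarith

lemma noise_mulVec_dotProduct_self_le {p : ℝ} (hp : p ∈ Set.Ioo (0 : ℝ) 1)
    (hcard : 512 / p ^ 4 ≤ Fintype.card V) {ω : PotentialEdge V → Bool}
    (h : sqTail p (p ^ 2 / 32) ω < 1) (x : V → ℝ) :
    (noise p ω *ᵥ x) ⬝ᵥ (noise p ω *ᵥ x) ≤ (p * Fintype.card V / 4) ^ 2 * (x ⬝ᵥ x) := by
  have hp0 := hp.1
  refine mulVec_dotProduct_self_le_of_sq (noise_isSymm p ω) (sq_nonneg _) ?_ x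
  have hdiag : ∀ i : V, |(noise p ω * noise p ω) i i| ≤ Fintype.card V := by
    intro i
    rw [mul_apply]
    calc _ ≤ ∑ k : V, (1 : ℝ) := by
          refine (abs_sum_le_sum_abs _ _).trans (sum_le_sum fun k _ => ?_)
          rw [abs_mul]
          exact mul_le_one₀ (abs_noise_le_one hp ω _ _) (abs_nonneg _) (abs_noise_le_one hp ω _ _)
      _ = _ := by simp
  calc _ ≤ ∑ i : V, ∑ j : V, ((p ^ 2 / 32 * (Fintype.card V : ℝ)) ^ 2 +
        if i = j then (Fintype.card V : ℝ) ^ 2 else 0) := by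
        gcongr with i _ j _
        by_cases hij : i = j
        · subst hij
          rw [if_pos rfl]
          have := sq_le_sq.2 ((hdiag i).trans (le_abs_self _))
          nlinarith [sq_nonneg (p ^ 2 / 32 * (Fintype.card V : ℝ))]
        · rw [if_neg hij, add_zero]
          exact sq_le_sq.2 ((abs_noise_sq_le_of_sqTail_lt_one (by positivity) h hij).trans
            (le_abs_self _))
    _ = (p ^ 2 / 32) ^ 2 * Fintype.card V ^ 4 + Fintype.card V ^ 3 := by
      simp [sum_add_distrib]
      ring
    _ ≤ _ := by
      rw [div_le_iff₀ (by positivity)] at hcard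
      have h3 : (0 : ℝ) ≤ Fintype.card V ^ 3 := by positivity
      nlinarith [mul_le_mul_of_nonneg_left hcard h3]

theorem abs_bernExp_sSup_spectrum_sub_le [Nonempty V] {p : ℝ} (hp : p ∈ Set.Ioo (0 : ℝ) 1)
    (hcard : 512 / p ^ 4 ≤ Fintype.card V) {A : (PotentialEdge V → Bool) → Matrix V V ℝ}
    (hA : ∀ ω, (A ω).IsHermitian) (hA1 : ∀ ω i j, |A ω i j| ≤ 1)
    (hAW : ∀ ω i j, A ω i j = noise p ω i j + p - if i = j then p else 0) :
    |bernExp p (fun ω => sSup (spectrum ℝ (A ω))) - (((Fintype.card V : ℝ) - 1) * p + (1 - p))| ≤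
      (312 * (2 / p) ^ 6 + 48 * (4 + 1 / p + 1 / p ^ 2) / ((p ^ 2 / 32) ^ 2 / 4) ^ 4
        + 1 / p ^ 2 + 1) / Fintype.card V := by
  obtain ⟨hp0, hp1⟩ := id hp
  have ht0 : 0 < p ^ 2 / 32 := by positivity
  have hcardpos : 0 < (Fintype.card V : ℝ) := by exact_mod_cast Fintype.card_pos
  have hpt : ∀ ω, |sSup (spectrum ℝ (A ω)) + p - p * Fintype.card V
      - (1 ⬝ᵥ (noise p ω *ᵥ 1)) / Fintype.card V
      - ((noise p ω *ᵥ 1) ⬝ᵥ (noise p ω *ᵥ 1)) / (p * Fintype.card V ^ 2)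
      - ((noise p ω *ᵥ 1) ⬝ᵥ (noise p ω *ᵥ (noise p ω *ᵥ 1))) / (p ^ 2 * Fintype.card V ^ 3)| ≤
      52 * (2 / p) ^ 6 * (((noise p ω *ᵥ (noise p ω *ᵥ 1)) ⬝ᵥ (noise p ω *ᵥ (noise p ω *ᵥ 1)))
        / Fintype.card V ^ 4 + (1 ⬝ᵥ (noise p ω *ᵥ 1)) ^ 2 / Fintype.card V ^ 3)
      + (4 + 1 / p + 1 / p ^ 2) * Fintype.card V * sqTail p (p ^ 2 / 32) ω := by
    intro ω
    have hK := dotProduct_self_nonneg_real (noise p ω *ᵥ (noise p ω *ᵥ 1))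
    have hZ := sqTail_nonneg p (p ^ 2 / 32) ω
    rcases lt_or_ge (sqTail p (p ^ 2 / 32) ω) 1 with h | h
    · refine (abs_sSup_spectrum_sub_expansion_le hp (noise_isSymm p ω) (hA ω) (hAW ω)
        (noise_mulVec_dotProduct_self_le hp hcard h)).trans (le_add_of_nonneg_right ?_)
      positivity
    · refine (abs_sSup_spectrum_sub_expansion_le_card hp (hA ω) (abs_noise_le_one hp ω)
        (hA1 ω)).trans ((le_mul_of_one_le_right (by positivity) h).trans
          (le_add_of_nonneg_left ?_))
      positivity
  have hE := abs_bernExp_le hp hpt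
  simp only [bernExp_sub, bernExp_add, bernExp_div_const, bernExp_const_mul, bernExp_const,
    bernExp_sum_noise, bernExp_sum_degree_sq] at hE
  have hS := bernExp_sum_noise_sq_le (V := V) hp
  have hK := bernExp_walk_sq_le (V := V) hp
  have hQ := abs_bernExp_degree_dotProduct_le (V := V) hp
  have hZ := bernExp_sqTail_le (V := V) hp ht0 (by nlinarith)
  have hexp := Real.pow_div_factorial_le_exp
    ((p ^ 2 / 32) ^ 2 / 4 * (Fintype.card V : ℝ)) (by positivity) 4
  set N : ℝ := (Fintype.card V : ℝ)
  set a : ℝ := (p ^ 2 / 32) ^ 2 / 4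
  have ha : 0 < a := by positivity
  have hc : 0 < 4 + 1 / p + 1 / p ^ 2 := by positivity
  set c : ℝ := 4 + 1 / p + 1 / p ^ 2
  set Eθ := bernExp p fun ω => sSup (spectrum ℝ (A ω))
  set EQ := bernExp p fun ω =>
    (noise (V := V) p ω *ᵥ 1) ⬝ᵥ (noise p ω *ᵥ (noise p ω *ᵥ 1))
  have htail : N * bernExp p (sqTail (V := V) p (p ^ 2 / 32)) ≤ 48 / a ^ 4 / N := by
    have h24 : (Nat.factorial 4 : ℝ) = 24 := by norm_num [Nat.factorial]
    rw [h24] at hexp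
    have h1 : Real.exp (-(a * N)) ≤ 24 / (a * N) ^ 4 := by
      rw [Real.exp_neg, inv_le_comm₀ (Real.exp_pos _) (by positivity), inv_div]
      exact hexp
    calc _ ≤ N * (2 * N ^ 2 * (24 / (a * N) ^ 4)) := by
          gcongr
          exact hZ.trans (by gcongr)
      _ = _ := by
        field_simp
        norm_num
  have hmain : 52 * (2 / p) ^ 6 * (4 * N ^ 3 / N ^ 4 + 2 * N ^ 2 / N ^ 3) =
      312 * (2 / p) ^ 6 / N := by
    field_simp
    norm_num
  have hQ' : |EQ / (p ^ 2 * N ^ 3)| ≤ 1 / p ^ 2 / N := by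
    rw [abs_div, abs_of_pos (by positivity : 0 < p ^ 2 * N ^ 3)]
    calc _ ≤ N ^ 2 / (p ^ 2 * N ^ 3) := by gcongr
      _ = _ := by field_simp
  have hD : N * (N - 1) * (p * (1 - p)) / (p * N ^ 2) = (1 - p) - (1 - p) / N := by
    field_simp
  have hlast : |(1 - p) / N| ≤ 1 / N := by
    rw [abs_div, abs_of_pos hcardpos, abs_of_pos (by linarith)]
    gcongr
    linarith
  have hY := hE.trans (b := _) (c := 312 * (2 / p) ^ 6 / N + c * (48 / a ^ 4 / N)) (by
    rw [← hmain, mul_assoc c]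
    gcongr)
  rw [hD, zero_div] at hY
  have hsplit : (312 * (2 / p) ^ 6 + 48 * c / a ^ 4 + 1 / p ^ 2 + 1) / N =
      312 * (2 / p) ^ 6 / N + c * (48 / a ^ 4 / N) + 1 / p ^ 2 / N + 1 / N := by ring
  rw [hsplit]
  rw [abs_le] at hY hQ' hlast ⊢
  constructor <;> linarith

end RandomMatrix

section ErdosRenyi

/-- Graphs on `V` correspond to their edge indicators on the potential edges. -/
noncomputable def edgeBits (V : Type*) : (PotentialEdge V → Bool) ≃ SimpleGraph V where
  toFun ω :=
    { Adj := fun i j => ∃ h : i ≠ j, ω ⟨s(i, j), by simpa using h⟩ = true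
      symm := ⟨fun i j ⟨h, hω⟩ => ⟨h.symm, by simpa only [Sym2.eq_swap (a := j)] using hω⟩⟩
      loopless := ⟨fun i ⟨h, _⟩ => h rfl⟩ }
  invFun g e := decide (e.1 ∈ g.edgeSet)
  left_inv ω := by
    funext ⟨e, he⟩
    induction e with | _ i j
    simp at he
    simp [he]
  right_inv g := by
    ext i j
    simpa using fun h => g.ne_of_adj h

lemma edgeBits_adj {V : Type*} (ω : PotentialEdge V → Bool) (i j : V) :
    (edgeBits V ω).Adj i j ↔ ∃ h : i ≠ j, ω ⟨s(i, j), by simpa using h⟩ = true :=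
  Iff.rfl

variable {n : ℕ}

lemma erWeight_eq_prod (p : ℝ) (g : SimpleGraph (Fin n)) :
    erWeight n p g = ∏ e, if (edgeBits (Fin n)).symm g e then p else 1 - p := by
  have hcard : Fintype.card (PotentialEdge (Fin n)) = n.choose 2 := by
    rw [Sym2.card_subtype_not_diag, Fintype.card_fin]
  have hedge : #{e : PotentialEdge (Fin n) | (edgeBits (Fin n)).symm g e = true} =
      edgeCount g := by
    rw [edgeCount, ← card_map (Function.Embedding.subtype _)]
    congr 1
    ext e
    simp only [edgeBits, mem_map, mem_filter, mem_univ, true_and, Equiv.coe_fn_symm_mk,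
      decide_eq_true_eq, Function.Embedding.subtype_apply, Subtype.exists, exists_and_left,
      SimpleGraph.mem_edgeFinset]
    constructor
    · rintro ⟨e', h, _, rfl⟩
      exact h
    · exact fun h => ⟨e, h, g.not_isDiag_of_mem_edgeSet h, rfl⟩
  rw [prod_ite, prod_const, prod_const, erWeight, hedge, ← hcard, ← hedge, ← card_univ,
    filter_not, card_sdiff_of_subset (filter_subset _ _)]

lemma erExp_eq_bernExp (p : ℝ) (f : SimpleGraph (Fin n) → ℝ) :
    erExp n p f = bernExp p (fun ω => f (edgeBits (Fin n) ω)) := by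
  rw [erExp, bernExp, ← Equiv.sum_comp (edgeBits (Fin n))]
  simp only [erWeight_eq_prod, Equiv.symm_apply_apply]
  congr!

lemma adjMat_edgeBits (p : ℝ) (ω : PotentialEdge (Fin n) → Bool) (i j : Fin n) :
    adjMat (edgeBits (Fin n) ω) i j = noise p ω i j + p - if i = j then p else 0 := by
  rw [adjMat, SimpleGraph.adjMatrix_apply, noise]
  by_cases hij : i = j
  · simp [hij]
  · by_cases hω : ω ⟨s(i, j), by simpa using hij⟩ = true
    · rw [if_pos ((edgeBits_adj ω i j).2 ⟨hij, hω⟩), dif_neg hij, if_pos hω, if_neg hij]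
      ring
    · rw [if_neg fun h => hω ((edgeBits_adj ω i j).1 h).2, dif_neg hij, if_neg hω, if_neg hij]
      ring

end ErdosRenyi

/-- Füredi–Komlós / Erdős–Knowles–Yau–Yin asymptotics in the dense regime:
for fixed `p ∈ (0,1)` there are `C > 0` and `N` such that for all `n ≥ N`,
`| E_{G(n,p)}[λ₁] − ((n−1)p + (1−p)) | ≤ C/n`. -/
theorem expected_largest_eigenvalue_erdos_renyi
    (p : ℝ) (hp : p ∈ Set.Ioo (0 : ℝ) 1) :
    ∃ C : ℝ, 0 < C ∧ ∃ N : ℕ, ∀ n : ℕ, N ≤ n →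
      |erExp n p (fun g => lam1 (adjMat g)) - (((n : ℝ) - 1) * p + (1 - p))|
        ≤ C / n := by
  have hp0 := hp.1
  refine ⟨312 * (2 / p) ^ 6 + 48 * (4 + 1 / p + 1 / p ^ 2) / ((p ^ 2 / 32) ^ 2 / 4) ^ 4
    + 1 / p ^ 2 + 1, by positivity, ⌈512 / p ^ 4⌉₊, fun n hn => ?_⟩
  have hn' : 512 / p ^ 4 ≤ n := Nat.ceil_le.1 hn
  have hpos : (0 : ℝ) < n := lt_of_lt_of_le (by positivity) hn'
  have : NeZero n := ⟨by rintro rfl; simp at hpos⟩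
  have h := abs_bernExp_sSup_spectrum_sub_le (V := Fin n) hp (by simpa using hn')
    (A := fun ω => adjMat (edgeBits (Fin n) ω))
    (fun ω => (edgeBits (Fin n) ω).isSymm_adjMatrix)
    (fun ω i j => by
      rw [adjMat, SimpleGraph.adjMatrix_apply]
      split_ifs <;> simp)
    (adjMat_edgeBits p)
  rw [erExp_eq_bernExp]
  simpa only [Fintype.card_fin, lam1] using h
end

section
/- Let n ≥ 1, let A_0 be an n×n real symmetric matrix, let e ∈ ℝⁿ be a unit vector, let f ∈ ℝ with f ≠ 0, and set A = A_0 + f · e eᵀ. Let λ be the largest eigenvalue of the symmetric matrix A and suppose λ > ‖A_0‖_op, the operator norm of A_0. Then λ > 0, the series Σ_{k=0}^∞ ⟨e, (λ^{-1} A_0)^k e⟩ converges absolutely, and λ = f · Σ_{k=0}^∞ ⟨e, (λ^{-1} A_0)^k e⟩. -/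
open Matrix Finset

/-- The ℓ² → ℓ² operator norm of a real `n × n` matrix. -/
noncomputable def opNorm {n : ℕ} (M : Matrix (Fin n) (Fin n) ℝ) : ℝ :=
  sSup {c : ℝ | ∃ x : Fin n → ℝ, (∑ i, x i ^ 2) ≤ 1 ∧
    c = Real.sqrt (∑ i, (M.mulVec x i) ^ 2)}

section L2Operator

open scoped Matrix.Norms.L2Operator

theorem opNorm_nonneg {n : ℕ} (M : Matrix (Fin n) (Fin n) ℝ) : 0 ≤ opNorm M := by
  apply Real.sSup_nonneg
  rintro c ⟨x, -, rfl⟩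
  positivity

theorem l2_norm_le_opNorm {n : ℕ} (M : Matrix (Fin n) (Fin n) ℝ) : ‖M‖ ≤ opNorm M := by
  have hnorm (y : EuclideanSpace ℝ (Fin n)) :
      Real.sqrt (∑ i, (M.mulVec y.ofLp i) ^ 2) = ‖toEuclideanCLM (n := Fin n) (𝕜 := ℝ) M y‖ := by
    simp [EuclideanSpace.norm_eq]
  rw [← l2_opNorm_toEuclideanCLM]
  refine ContinuousLinearMap.opNorm_le_of_unit_norm (opNorm_nonneg M) fun x hx => ?_
  refine le_csSup ⟨‖M‖, ?_⟩ ⟨x.ofLp, ?_, (hnorm x).symm⟩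
  · rintro c ⟨y, hy, rfl⟩
    rw [hnorm (WithLp.toLp 2 y)]
    refine ContinuousLinearMap.unit_le_opNorm _ _ ?_
    rw [EuclideanSpace.norm_eq]
    simpa using hy
  · rw [← EuclideanSpace.real_norm_sq_eq, hx, one_pow]

/-- The Neumann series of a matrix of `ℓ²` operator norm less than one. -/
theorem exists_hasSum_pow_of_l2_norm_lt_one {n : ℕ} {B : Matrix (Fin n) (Fin n) ℝ}
    (hB : ‖B‖ < 1) : ∃ S, HasSum (fun k : ℕ => B ^ k) S ∧ S * (1 - B) = 1 :=
  have : CompleteSpace (Matrix (Fin n) (Fin n) ℝ) := FiniteDimensional.complete ℝ _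
  ⟨_, (summable_geometric_of_norm_lt_one hB).hasSum, geom_series_mul_neg B hB⟩

theorem exists_hasSum_inv_smul_pow {n : ℕ} {M : Matrix (Fin n) (Fin n) ℝ} {l : ℝ}
    (hl : opNorm M < l) :
    ∃ S, HasSum (fun k : ℕ => (l⁻¹ • M) ^ k) S ∧ S * (1 - l⁻¹ • M) = 1 := by
  have hl0 : 0 < l := (opNorm_nonneg M).trans_lt hl
  apply exists_hasSum_pow_of_l2_norm_lt_one
  rw [norm_smul, norm_inv, Real.norm_of_nonneg hl0.le, inv_mul_lt_one₀ hl0]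
  exact (l2_norm_le_opNorm M).trans_lt hl

end L2Operator

theorem exists_mulVec_eq_lam1_smul {n : ℕ} {M : Matrix (Fin n) (Fin n) ℝ} (hM : lam1 M ≠ 0) :
    ∃ v ≠ 0, M *ᵥ v = lam1 M • v := by
  have hne : (spectrum ℝ M).Nonempty := by
    rw [Set.nonempty_iff_ne_empty]
    intro h
    simp [lam1, h] at hM
  have hmem : lam1 M ∈ spectrum ℝ M := hne.csSup_mem M.finite_spectrum
  rw [← spectrum_toLin', ← Module.End.hasEigenvalue_iff_mem_spectrum] at hmem
  obtain ⟨v, hv⟩ := hmem.exists_hasEigenvector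
  exact ⟨v, hv.2, by simpa using hv.apply_eq_smul⟩

theorem hasSum_dotProduct_mulVec {n : ℕ} {F : ℕ → Matrix (Fin n) (Fin n) ℝ}
    {S : Matrix (Fin n) (Fin n) ℝ} (hF : HasSum F S) (u w : Fin n → ℝ) :
    HasSum (fun k => u ⬝ᵥ F k *ᵥ w) (u ⬝ᵥ S *ᵥ w) :=
  hF.map (⟨⟨fun M => u ⬝ᵥ M *ᵥ w, by simp⟩, fun M N => by
    simp [add_mulVec, dotProduct_add]⟩ : Matrix (Fin n) (Fin n) ℝ →+ ℝ) (by
      change Continuous fun M : Matrix (Fin n) (Fin n) ℝ => u ⬝ᵥ M *ᵥ w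
      fun_prop)

/-- Series expansion for the largest eigenvalue of a symmetric matrix plus a rank-one
perturbation.  Let `A = A₀ + f · e eᵀ` with `A₀` symmetric, `e` a unit vector and
`f ≠ 0`, and let `λ` be the largest eigenvalue of `A`.  If `λ > ‖A₀‖_op`, then
`λ > 0`, the series `Σ_k ⟨e, (λ⁻¹A₀)^k e⟩` converges absolutely, and
`λ = f · Σ_{k=0}^∞ ⟨e, (λ⁻¹A₀)^k e⟩`. -/
theorem largest_eigenvalue_rank_one_perturbation_series
    {n : ℕ} (hn : 1 ≤ n)
    (A₀ : Matrix (Fin n) (Fin n) ℝ) (hA₀ : A₀.IsSymm)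
    (e : Fin n → ℝ) (he : ∑ i, e i ^ 2 = 1)
    (f : ℝ) (hf : f ≠ 0)
    (A : Matrix (Fin n) (Fin n) ℝ) (hA : A = A₀ + f • vecMulVec e e)
    (hgap : opNorm A₀ < lam1 A) :
    0 < lam1 A ∧
      Summable (fun k : ℕ => |e ⬝ᵥ (((lam1 A)⁻¹ • A₀) ^ k).mulVec e|) ∧
      lam1 A = f * ∑' k : ℕ, e ⬝ᵥ (((lam1 A)⁻¹ • A₀) ^ k).mulVec e := by
  have hl0 : 0 < lam1 A := (opNorm_nonneg A₀).trans_lt hgap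
  obtain ⟨S, hS, hinv⟩ := exists_hasSum_inv_smul_pow hgap
  have hsum := hasSum_dotProduct_mulVec hS e e
  refine ⟨hl0, hsum.summable.abs, ?_⟩
  rw [hsum.tsum_eq]
  obtain ⟨v, hv0, hv⟩ := exists_mulVec_eq_lam1_smul hl0.ne'
  generalize lam1 A = l at *
  have hres : (1 - l⁻¹ • A₀) *ᵥ v = (l⁻¹ * (f * (e ⬝ᵥ v))) • e := by
    have hA₀v : A₀ *ᵥ v = l • v - (f * (e ⬝ᵥ v)) • e := by
      rw [← hv, hA, add_mulVec, smul_mulVec, vecMulVec_mulVec]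
      ext i
      simp
      ring
    rw [sub_mulVec, one_mulVec, smul_mulVec, hA₀v, smul_sub, inv_smul_smul₀ hl0.ne', smul_smul,
      sub_sub_cancel]
  have hvS : v = (l⁻¹ * (f * (e ⬝ᵥ v))) • S *ᵥ e := by
    rw [← mulVec_smul, ← hres, mulVec_mulVec, hinv, one_mulVec]
  have hev : e ⬝ᵥ v ≠ 0 := by
    intro h
    rw [h] at hvS
    exact hv0 (by simpa using hvS)
  have hdot := congrArg (e ⬝ᵥ ·) hvS
  simp only [dotProduct_smul, smul_eq_mul] at hdot
  field_simp at hdot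
  linarith
end
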